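/- Let r ≠ s with r + s ≥ 1, and suppose a pseudo H-type Lie algebra n_{r,s} = V₁ ⊕ ℝ^{r+s} of signature (r,s) is isomorphic as a Lie algebra to a pseudo H-type Lie algebra n_{s,r} = V₂ ⊕ ℝ^{s+r} of signature (s,r). Then there exists a Lie algebra isomorphism φ : n_{r,s} → n_{s,r} mapping ℝ^{r+s} onto ℝ^{s+r} whose restriction C : ℝ^{r+s} → ℝ^{s+r} to the centers satisfies C ∘ C^τ = −Id_{ℝ^{s+r}} and C^τ ∘ C = −Id_{ℝ^{r+s}}; in particular C and C^τ are anti-isometries. -/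

import Mathlib

/-- The standard scalar product of signature `(r,s)` on `ℝ^(r+s)`:
`⟨Z,W⟩_{r,s} = ∑_{i<r} Z i * W i - ∑_{r ≤ i < r+s} Z i * W i`. -/
def sform (r s : ℕ) (Z W : Fin (r + s) → ℝ) : ℝ :=
  ∑ i : Fin (r + s), (if (i : ℕ) < r then (1 : ℝ) else -1) * Z i * W i

/-- `(V, B, J)` is an admissible module of the Clifford algebra `Cl_{r,s}`:
`V` is a nonzero finite-dimensional real vector space, `B` a nondegenerate
symmetric bilinear form on `V`, and `J : ℝ^{r+s} → End V` linear with
`J_Z ∘ J_Z = -⟨Z,Z⟩_{r,s} • id` and each `J_Z` skew-adjoint w.r.t. `B`. -/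
def IsAdmissible (r s : ℕ) (V : Type) [AddCommGroup V] [Module ℝ V]
    (B : V →ₗ[ℝ] V →ₗ[ℝ] ℝ)
    (J : (Fin (r + s) → ℝ) →ₗ[ℝ] V →ₗ[ℝ] V) : Prop :=
  FiniteDimensional ℝ V ∧ Nontrivial V ∧
  (∀ v w : V, B v w = B w v) ∧
  (∀ v : V, (∀ w : V, B v w = 0) → v = 0) ∧
  (∀ (Z : Fin (r + s) → ℝ) (v : V), J Z (J Z v) = (-(sform r s Z Z)) • v) ∧
  (∀ (Z : Fin (r + s) → ℝ) (v w : V), B (J Z v) w = -(B v (J Z w)))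

/-- A minimal admissible `Cl_{r,s}`-module: one of least possible dimension. -/
def IsMinimalAdmissible (r s : ℕ) (V : Type) [AddCommGroup V] [Module ℝ V]
    (B : V →ₗ[ℝ] V →ₗ[ℝ] ℝ)
    (J : (Fin (r + s) → ℝ) →ₗ[ℝ] V →ₗ[ℝ] V) : Prop :=
  IsAdmissible r s V B J ∧
  ∀ (V' : Type) [AddCommGroup V'] [Module ℝ V']
    (B' : V' →ₗ[ℝ] V' →ₗ[ℝ] ℝ)
    (J' : (Fin (r + s) → ℝ) →ₗ[ℝ] V' →ₗ[ℝ] V'),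
    IsAdmissible r s V' B' J' → Module.finrank ℝ V ≤ Module.finrank ℝ V'

/-- `br` is the Lie bracket of the pseudo `H`-type Lie algebra `V ⊕ ℝ^{r+s}`
determined by the admissible module `(V,B,J)`, i.e.
`⟨Z, [v,w]⟩_{r,s} = ⟨J_Z v, w⟩_V` for all `Z, v, w`. -/
def IsHBracket (r s : ℕ) (V : Type) [AddCommGroup V] [Module ℝ V]
    (B : V →ₗ[ℝ] V →ₗ[ℝ] ℝ)
    (J : (Fin (r + s) → ℝ) →ₗ[ℝ] V →ₗ[ℝ] V)
    (br : V →ₗ[ℝ] V →ₗ[ℝ] (Fin (r + s) → ℝ)) : Prop :=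
  ∀ (Z : Fin (r + s) → ℝ) (v w : V), sform r s Z (br v w) = B (J Z v) w

/-- A linear equivalence `f` between the pseudo `H`-type Lie algebras
`V₁ ⊕ ℝ^{n₁}` and `V₂ ⊕ ℝ^{n₂}` (with 2-step brackets `br₁`, `br₂`, the
`ℝ^{nᵢ}` factors being central) is a Lie algebra isomorphism. -/
def IsLieIso {V₁ : Type} [AddCommGroup V₁] [Module ℝ V₁]
    {V₂ : Type} [AddCommGroup V₂] [Module ℝ V₂] {n₁ n₂ : ℕ}
    (br₁ : V₁ →ₗ[ℝ] V₁ →ₗ[ℝ] (Fin n₁ → ℝ))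
    (br₂ : V₂ →ₗ[ℝ] V₂ →ₗ[ℝ] (Fin n₂ → ℝ))
    (f : (V₁ × (Fin n₁ → ℝ)) ≃ₗ[ℝ] (V₂ × (Fin n₂ → ℝ))) : Prop :=
  ∀ x y : V₁ × (Fin n₁ → ℝ),
    f (0, br₁ x.1 y.1) = (0, br₂ (f x).1 (f y).1)

/-- The standard scalar product of signature `(r,s)` as a bilinear form. -/
def sformBilin (r s : ℕ) : LinearMap.BilinForm ℝ (Fin (r + s) → ℝ) :=
  LinearMap.mk₂ ℝ (sform r s)
    (fun x y z => by
      simp only [sform, Pi.add_apply, ← Finset.sum_add_distrib]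
      exact Finset.sum_congr rfl fun i _ => by ring)
    (fun a x y => by
      simp only [sform, Pi.smul_apply, smul_eq_mul, Finset.mul_sum]
      exact Finset.sum_congr rfl fun i _ => by ring)
    (fun x y z => by
      simp only [sform, Pi.add_apply, ← Finset.sum_add_distrib]
      exact Finset.sum_congr rfl fun i _ => by ring)
    (fun a x y => by
      simp only [sform, Pi.smul_apply, smul_eq_mul, Finset.mul_sum]
      exact Finset.sum_congr rfl fun i _ => by ring)

@[simp]
lemma sformBilin_apply (r s : ℕ) (Z W : Fin (r + s) → ℝ) :
    sformBilin r s Z W = sform r s Z W := rfl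

lemma sform_comm (r s : ℕ) (Z W : Fin (r + s) → ℝ) : sform r s Z W = sform r s W Z :=
  Finset.sum_congr rfl fun i _ => by ring

lemma eq_zero_of_sform_eq_zero {r s : ℕ} {Z : Fin (r + s) → ℝ}
    (h : ∀ W, sform r s Z W = 0) : Z = 0 := by
  funext i
  have hi := h (Pi.single i 1)
  simp only [sform, Pi.single_apply, mul_ite, mul_one, mul_zero, Finset.sum_ite_eq',
    Finset.mem_univ, if_true] at hi
  split_ifs at hi <;> simpa using hi

/-- Two vectors with the same scalar products against all vectors are equal. -/
lemma sform_ext {r s : ℕ} {Z Z' : Fin (r + s) → ℝ}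
    (h : ∀ W, sform r s Z W = sform r s Z' W) : Z = Z' := by
  refine sub_eq_zero.mp (eq_zero_of_sform_eq_zero (r := r) (s := s) fun W => ?_)
  rw [← sformBilin_apply, map_sub, LinearMap.sub_apply, sformBilin_apply, sformBilin_apply, h,
    sub_self]

/-- A linear map into a space with a bilinear form has an adjoint with respect to a
nondegenerate symmetric form on its finite-dimensional source. -/
lemma exists_bilin_adjoint {V W : Type*} [AddCommGroup V] [Module ℝ V] [FiniteDimensional ℝ V]
    [AddCommGroup W] [Module ℝ W] (B : LinearMap.BilinForm ℝ V) (B' : LinearMap.BilinForm ℝ W)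
    (hB : ∀ v, (∀ w, B v w = 0) → v = 0) (A : V →ₗ[ℝ] W) :
    ∃ S : W →ₗ[ℝ] V, ∀ x v, B (S x) v = B' x (A v) := by
  have hinj : Function.Injective B := by
    rw [injective_iff_map_eq_zero]
    intro v hv
    exact hB v fun w => by rw [hv]; rfl
  let e : V ≃ₗ[ℝ] Module.Dual ℝ V :=
    LinearEquiv.ofInjectiveOfFinrankEq B hinj (Subspace.dual_finrank_eq).symm
  refine ⟨e.symm.toLinearMap ∘ₗ A.dualMap ∘ₗ B', fun x v => ?_⟩
  change e (e.symm (A.dualMap (B' x))) v = _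
  rw [e.apply_symm_apply]
  rfl

/-- If the product of two quadratic forms vanishes identically, one of them vanishes. -/
lemma bilin_self_eq_zero_or {V : Type*} [AddCommGroup V] [Module ℝ V]
    (Q R : LinearMap.BilinForm ℝ V) (h : ∀ x, Q x x * R x x = 0) :
    (∀ x, Q x x = 0) ∨ ∀ x, R x x = 0 := by
  by_contra! ⟨⟨a, ha⟩, b, hb⟩
  have hline (P : LinearMap.BilinForm ℝ V) (t : ℝ) : P (a + t • b) (a + t • b) =
      (Polynomial.C (P a a) + Polynomial.C (P a b + P b a) * Polynomial.X
        + Polynomial.C (P b b) * Polynomial.X ^ 2).eval t := by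
    simp
    ring
  have hzero : (Polynomial.C (Q a a) + Polynomial.C (Q a b + Q b a) * Polynomial.X
        + Polynomial.C (Q b b) * Polynomial.X ^ 2) *
      (Polynomial.C (R a a) + Polynomial.C (R a b + R b a) * Polynomial.X
        + Polynomial.C (R b b) * Polynomial.X ^ 2) = 0 := by
    refine Polynomial.funext fun t => ?_
    rw [Polynomial.eval_mul, ← hline, ← hline, h, Polynomial.eval_zero]
  rcases mul_eq_zero.mp hzero with h0 | h0
  · exact ha (by simpa using congrArg (Polynomial.eval 0) h0)
  · exact hb (by simpa [Polynomial.coeff_X] using congrArg (Polynomial.coeff · 2) h0)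

/-- Scalar products of signatures `(r,s)` and `(s,r)` with `r ≠ s` are not positively similar. -/
lemma not_sform_similar {r s : ℕ} (hrs : r ≠ s) {c : ℝ} (hc : 0 < c)
    (T : (Fin (s + r) → ℝ) →ₗ[ℝ] (Fin (r + s) → ℝ)) :
    ¬ ∀ ζ, sform r s (T ζ) (T ζ) = c * sform s r ζ ζ := by
  intro h
  have sform_add (m n : ℕ) (Z : Fin (m + n) → ℝ) : sform m n Z Z =
      ∑ i : Fin m, Z (Fin.castAdd n i) ^ 2 - ∑ j : Fin n, Z (Fin.natAdd m j) ^ 2 := by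
    simp only [sform, Fin.sum_univ_add, Fin.val_castAdd, Fin.val_natAdd, Fin.is_lt, if_true,
      Nat.not_lt.mpr (Nat.le_add_right _ _), if_false, sub_eq_add_neg, ← Finset.sum_neg_distrib]
    congr 1
    all_goals exact Finset.sum_congr rfl fun i _ => by ring
  have sum_sq_pos {n : ℕ} {x : Fin n → ℝ} (hx : x ≠ 0) : 0 < ∑ i, x i ^ 2 := by
    obtain ⟨i, hi⟩ := Function.ne_iff.mp hx
    exact Finset.sum_pos' (fun _ _ => sq_nonneg _) ⟨i, Finset.mem_univ i, sq_pos_of_ne_zero hi⟩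
  rcases lt_or_gt_of_ne hrs with hlt | hlt
  · let E : (Fin s → ℝ) →ₗ[ℝ] (Fin (s + r) → ℝ) :=
      LinearMap.pi (Fin.addCases (fun i => LinearMap.proj i) fun _ => 0)
    obtain ⟨x, hx, hx0⟩ := (Submodule.ne_bot_iff _).mp (LinearMap.ker_ne_bot_of_finrank_lt
      (f := LinearMap.funLeft ℝ ℝ (Fin.castAdd s) ∘ₗ T ∘ₗ E) (by simpa using hlt))
    have hx' (i : Fin r) : T (E x) (Fin.castAdd s i) = 0 := congrFun (LinearMap.mem_ker.mp hx) i
    have hq := h (E x)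
    have hpos := mul_pos hc (sum_sq_pos hx0)
    simp only [sform_add, hx'] at hq
    simp [E] at hq
    have : 0 ≤ ∑ j : Fin s, T (E x) (Fin.natAdd r j) ^ 2 := by positivity
    linarith
  · let E : (Fin r → ℝ) →ₗ[ℝ] (Fin (s + r) → ℝ) :=
      LinearMap.pi (Fin.addCases (fun _ => 0) fun j => LinearMap.proj j)
    obtain ⟨x, hx, hx0⟩ := (Submodule.ne_bot_iff _).mp (LinearMap.ker_ne_bot_of_finrank_lt
      (f := LinearMap.funLeft ℝ ℝ (Fin.natAdd r) ∘ₗ T ∘ₗ E) (by simpa using hlt))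
    have hx' (j : Fin s) : T (E x) (Fin.natAdd r j) = 0 := congrFun (LinearMap.mem_ker.mp hx) j
    have hq := h (E x)
    have hpos := mul_pos hc (sum_sq_pos hx0)
    simp only [sform_add, hx'] at hq
    simp [E] at hq
    have : 0 ≤ ∑ i : Fin r, T (E x) (Fin.castAdd s i) ^ 2 := by positivity
    linarith

namespace IsAdmissible

variable {r s : ℕ} {V : Type} [AddCommGroup V] [Module ℝ V] {B : V →ₗ[ℝ] V →ₗ[ℝ] ℝ}
  {J : (Fin (r + s) → ℝ) →ₗ[ℝ] V →ₗ[ℝ] V}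
  {br : V →ₗ[ℝ] V →ₗ[ℝ] (Fin (r + s) → ℝ)}

/-- The Clifford action is faithful on vectors. -/
lemma eq_zero_of_action_eq_zero (h : IsAdmissible r s V B J) {Z : Fin (r + s) → ℝ}
    (hZ : J Z = 0) : Z = 0 := by
  obtain ⟨-, hnt, -, -, hsq, -⟩ := h
  obtain ⟨v, hv⟩ := exists_ne (0 : V)
  have hq (W : Fin (r + s) → ℝ) : sform r s (Z + W) (Z + W) = sform r s W W := by
    have h1 := hsq (Z + W) v
    rw [map_add, hZ, zero_add, hsq W v] at h1
    exact (neg_injective (smul_left_injective ℝ hv h1)).symm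
  refine eq_zero_of_sform_eq_zero fun W => ?_
  have h0 := hq 0
  have hW := hq W
  have hexp : sform r s (Z + W) (Z + W) =
      sform r s Z Z + 2 * sform r s Z W + sform r s W W := by
    simp only [← sformBilin_apply, map_add, LinearMap.add_apply]
    simp only [sformBilin_apply, sform_comm r s W Z]
    ring
  have hz : sform r s (0 : Fin (r + s) → ℝ) 0 = 0 := by simp [sform]
  rw [add_zero, hz] at h0
  linarith

/-- The brackets span the centre. -/
lemma span_bracket_eq_top (h : IsAdmissible r s V B J) (hbr : IsHBracket r s V B J br) :
    Submodule.span ℝ {Z | ∃ v w, br v w = Z} = ⊤ := by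
  by_contra hne
  obtain ⟨f, hf0, hf⟩ := Submodule.exists_le_ker_of_lt_top _ (lt_top_iff_ne_top.mpr hne)
  obtain ⟨S, hS⟩ := exists_bilin_adjoint (sformBilin r s) (LinearMap.mul ℝ ℝ)
    (fun _ hv => eq_zero_of_sform_eq_zero hv) f
  have hSf (W : Fin (r + s) → ℝ) : sform r s (S 1) W = f W := by simpa using hS 1 W
  have hJ : J (S 1) = 0 := by
    ext v
    refine h.2.2.2.1 _ fun w => ?_
    rw [← hbr, hSf]
    exact hf (Submodule.subset_span ⟨v, w, rfl⟩)
  refine hf0 (LinearMap.ext fun W => ?_)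
  rw [← hSf, h.eq_zero_of_action_eq_zero hJ]
  simp [sform]

/-- A vector with vanishing brackets is zero when the centre is nontrivial. -/
lemma eq_zero_of_bracket_eq_zero (h : IsAdmissible r s V B J) (hbr : IsHBracket r s V B J br)
    (hpos : 1 ≤ r + s) {v : V} (hv : ∀ w, br v w = 0) : v = 0 := by
  let Z : Fin (r + s) → ℝ := Pi.single ⟨0, hpos⟩ 1
  have hJ : J Z v = 0 := h.2.2.2.1 _ fun w => by rw [← hbr, hv]; simp [sform]
  have hsq := h.2.2.2.2.1 Z v
  rw [hJ, map_zero, eq_comm, smul_eq_zero] at hsq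
  refine hsq.resolve_left ?_
  simp only [Z, sform, Pi.single_apply, mul_ite, mul_one, mul_zero, Finset.sum_ite_eq',
    Finset.mem_univ, if_true]
  split_ifs <;> simp

/-- The determinant of a Clifford action determines the absolute value of the scalar product. -/
lemma det_action_sq (h : IsAdmissible r s V B J) (Z : Fin (r + s) → ℝ) :
    LinearMap.det (J Z) ^ 2 = (-(sform r s Z Z)) ^ Module.finrank ℝ V := by
  have hsq : J Z ∘ₗ J Z = (-(sform r s Z Z)) • LinearMap.id :=
    LinearMap.ext fun v => h.2.2.2.2.1 Z v
  rw [sq, ← LinearMap.det_comp, hsq, LinearMap.det_smul, LinearMap.det_id, mul_one]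

end IsAdmissible

/-- If a Lie algebra isomorphism acts on the centres by `C`, then the adjoint of `C` multiplies
the absolute value of the scalar square by a positive constant. -/
lemma exists_abs_sform_adjoint_eq {r s p q : ℕ} (hpos : 1 ≤ r + s)
    {V1 V2 : Type} [AddCommGroup V1] [Module ℝ V1] [AddCommGroup V2] [Module ℝ V2]
    {B1 : V1 →ₗ[ℝ] V1 →ₗ[ℝ] ℝ} {J1 : (Fin (r + s) → ℝ) →ₗ[ℝ] V1 →ₗ[ℝ] V1}
    {br1 : V1 →ₗ[ℝ] V1 →ₗ[ℝ] (Fin (r + s) → ℝ)}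
    (hadm1 : IsAdmissible r s V1 B1 J1) (hbr1 : IsHBracket r s V1 B1 J1 br1)
    {B2 : V2 →ₗ[ℝ] V2 →ₗ[ℝ] ℝ} {J2 : (Fin (p + q) → ℝ) →ₗ[ℝ] V2 →ₗ[ℝ] V2}
    {br2 : V2 →ₗ[ℝ] V2 →ₗ[ℝ] (Fin (p + q) → ℝ)}
    (hadm2 : IsAdmissible p q V2 B2 J2) (hbr2 : IsHBracket p q V2 B2 J2 br2)
    (hdim : Module.finrank ℝ V1 = Module.finrank ℝ V2)
    {A : V1 →ₗ[ℝ] V2} {C : (Fin (r + s) → ℝ) →ₗ[ℝ] (Fin (p + q) → ℝ)}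
    (hC : Function.Injective C) (hA : ∀ v w, C (br1 v w) = br2 (A v) (A w))
    {Cτ : (Fin (p + q) → ℝ) →ₗ[ℝ] (Fin (r + s) → ℝ)}
    (hCτ : ∀ Z ζ, sform p q (C Z) ζ = sform r s Z (Cτ ζ)) :
    ∃ c : ℝ, 0 < c ∧ ∀ ζ, |sform r s (Cτ ζ) (Cτ ζ)| = c * |sform p q ζ ζ| := by
  have : FiniteDimensional ℝ V1 := hadm1.1
  have : FiniteDimensional ℝ V2 := hadm2.1
  have : Nontrivial V1 := hadm1.2.1
  have hAinj : Function.Injective A := by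
    rw [injective_iff_map_eq_zero]
    intro v hv
    refine hadm1.eq_zero_of_bracket_eq_zero hbr1 hpos fun w => hC ?_
    rw [hA, hv, map_zero, map_zero, LinearMap.zero_apply]
  let e : V1 ≃ₗ[ℝ] V2 := LinearEquiv.ofInjectiveOfFinrankEq A hAinj hdim
  have he (v : V1) : e v = A v := rfl
  obtain ⟨S, hS⟩ := exists_bilin_adjoint B1 B2 hadm1.2.2.2.1 A
  have hK : Function.Injective (S ∘ₗ A) := by
    rw [injective_iff_map_eq_zero]
    intro v hv
    rw [injective_iff_map_eq_zero] at hAinj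
    refine hAinj v (hadm2.2.2.2.1 _ fun w => ?_)
    obtain ⟨w, rfl⟩ := e.surjective w
    rw [he, ← hS]
    change B1 ((S ∘ₗ A) v) w = 0
    rw [hv, map_zero, LinearMap.zero_apply]
  have hdet : LinearMap.det (S ∘ₗ A) ≠ 0 :=
    (LinearEquiv.isUnit_det' (LinearEquiv.ofInjectiveEndo _ hK)).ne_zero
  have hconj (ζ : Fin (p + q) → ℝ) :
      (S ∘ₗ A) ∘ₗ (e.symm.toLinearMap ∘ₗ J2 ζ ∘ₗ e.toLinearMap) = J1 (Cτ ζ) := by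
    ext v
    change S (e (e.symm (J2 ζ (A v)))) = _
    rw [e.apply_symm_apply, ← sub_eq_zero]
    refine hadm1.2.2.2.1 _ fun w => ?_
    rw [map_sub, LinearMap.sub_apply, hS, ← hbr2, ← hA, sform_comm, hCτ, sform_comm, hbr1,
      sub_self]
  have hdetJ (ζ : Fin (p + q) → ℝ) :
      LinearMap.det (S ∘ₗ A) * LinearMap.det (J2 ζ) = LinearMap.det (J1 (Cτ ζ)) := by
    rw [← hconj, LinearMap.det_comp]
    congr 1
    exact (LinearMap.det_conj (J2 ζ) e.symm).symm
  have hN : Module.finrank ℝ V1 ≠ 0 := Module.finrank_pos.ne'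
  obtain ⟨c, hc, hcN⟩ : ∃ c : ℝ, 0 < c ∧
      c ^ Module.finrank ℝ V1 = LinearMap.det (S ∘ₗ A) ^ 2 :=
    ⟨(LinearMap.det (S ∘ₗ A) ^ 2) ^ ((Module.finrank ℝ V1 : ℝ)⁻¹), by positivity,
      Real.rpow_inv_natCast_pow (by positivity) hN⟩
  refine ⟨c, hc, fun ζ => ?_⟩
  refine (pow_left_inj₀ (abs_nonneg _) (by positivity) hN).mp ?_
  have hsq := congrArg (|· ^ 2|) (hdetJ ζ)
  simp only [mul_pow, hadm1.det_action_sq, hadm2.det_action_sq, abs_mul, abs_pow, abs_neg,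
    sq_abs, ← hdim] at hsq
  rw [mul_pow, hcN, hsq]

theorem stmt3 (r s : ℕ) (hrs : r ≠ s) (hpos : 1 ≤ r + s)
    (V1 : Type) [AddCommGroup V1] [Module ℝ V1]
    (B1 : V1 →ₗ[ℝ] V1 →ₗ[ℝ] ℝ)
    (J1 : (Fin (r + s) → ℝ) →ₗ[ℝ] V1 →ₗ[ℝ] V1)
    (br1 : V1 →ₗ[ℝ] V1 →ₗ[ℝ] (Fin (r + s) → ℝ))
    (hadm1 : IsAdmissible r s V1 B1 J1)
    (hbr1 : IsHBracket r s V1 B1 J1 br1)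
    (V2 : Type) [AddCommGroup V2] [Module ℝ V2]
    (B2 : V2 →ₗ[ℝ] V2 →ₗ[ℝ] ℝ)
    (J2 : (Fin (s + r) → ℝ) →ₗ[ℝ] V2 →ₗ[ℝ] V2)
    (br2 : V2 →ₗ[ℝ] V2 →ₗ[ℝ] (Fin (s + r) → ℝ))
    (hadm2 : IsAdmissible s r V2 B2 J2)
    (hbr2 : IsHBracket s r V2 B2 J2 br2)
    (hiso : ∃ f : (V1 × (Fin (r + s) → ℝ)) ≃ₗ[ℝ] (V2 × (Fin (s + r) → ℝ)),
      IsLieIso br1 br2 f) :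
    ∃ (φ : (V1 × (Fin (r + s) → ℝ)) ≃ₗ[ℝ] (V2 × (Fin (s + r) → ℝ)))
      (C : (Fin (r + s) → ℝ) →ₗ[ℝ] (Fin (s + r) → ℝ))
      (Cτ : (Fin (s + r) → ℝ) →ₗ[ℝ] (Fin (r + s) → ℝ)),
      IsLieIso br1 br2 φ ∧
      (∀ Z : Fin (r + s) → ℝ, φ (0, Z) = (0, C Z)) ∧
      Function.Surjective ⇑C ∧
      (∀ (Z : Fin (r + s) → ℝ) (ζ : Fin (s + r) → ℝ),
        sform s r (C Z) ζ = sform r s Z (Cτ ζ)) ∧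
      (∀ ζ : Fin (s + r) → ℝ, C (Cτ ζ) = -ζ) ∧
      (∀ Z : Fin (r + s) → ℝ, Cτ (C Z) = -Z) ∧
      (∀ Z Z' : Fin (r + s) → ℝ, sform s r (C Z) (C Z') = -(sform r s Z Z')) ∧
      (∀ ζ ζ' : Fin (s + r) → ℝ, sform r s (Cτ ζ) (Cτ ζ') = -(sform s r ζ ζ')) := by
  obtain ⟨f, hf⟩ := hiso
  have : FiniteDimensional ℝ V1 := hadm1.1
  have : FiniteDimensional ℝ V2 := hadm2.1
  have hdim : Module.finrank ℝ V1 = Module.finrank ℝ V2 := by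
    have := f.finrank_eq
    simp only [Module.finrank_prod, Module.finrank_fin_fun] at this
    omega
  have hfst : LinearMap.fst ℝ V2 (Fin (s + r) → ℝ) ∘ₗ f.toLinearMap ∘ₗ
      LinearMap.inr ℝ V1 (Fin (r + s) → ℝ) = 0 := by
    refine LinearMap.ext_on (hadm1.span_bracket_eq_top hbr1) ?_
    rintro _ ⟨v, w, rfl⟩
    exact congrArg Prod.fst (hf (v, 0) (w, 0))
  let C := LinearMap.snd ℝ V2 (Fin (s + r) → ℝ) ∘ₗ f.toLinearMap ∘ₗ
    LinearMap.inr ℝ V1 (Fin (r + s) → ℝ)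
  have hfC (Z : Fin (r + s) → ℝ) : f (0, Z) = (0, C Z) :=
    Prod.ext (LinearMap.congr_fun hfst Z) rfl
  have hC : Function.Injective C := fun Z Z' h => by
    have := f.injective ((hfC Z).trans ((congrArg (Prod.mk 0) h).trans (hfC Z').symm))
    exact congrArg Prod.snd this
  obtain ⟨Cτ, hCτ'⟩ := exists_bilin_adjoint (sformBilin r s) (sformBilin s r)
    (fun _ hv => eq_zero_of_sform_eq_zero hv) C
  have hCτ (Z : Fin (r + s) → ℝ) (ζ : Fin (s + r) → ℝ) :
      sform s r (C Z) ζ = sform r s Z (Cτ ζ) := by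
    rw [sform_comm, sform_comm r s]
    exact (hCτ' ζ Z).symm
  obtain ⟨c, hc, habs⟩ := exists_abs_sform_adjoint_eq hpos hadm1 hbr1 hadm2 hbr2 hdim
    (A := LinearMap.fst ℝ V2 (Fin (s + r) → ℝ) ∘ₗ f.toLinearMap ∘ₗ
      LinearMap.inl ℝ V1 (Fin (r + s) → ℝ)) hC
    (fun v w => congrArg Prod.snd (hf (v, 0) (w, 0))) hCτ
  have hneg (ζ : Fin (s + r) → ℝ) : sform r s (Cτ ζ) (Cτ ζ) = -(c * sform s r ζ ζ) := by
    have hor := bilin_self_eq_zero_or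
      ((sformBilin r s).compl₁₂ Cτ Cτ - c • sformBilin s r)
      ((sformBilin r s).compl₁₂ Cτ Cτ + c • sformBilin s r) fun ζ => by
        have := congrArg (· ^ 2) (habs ζ)
        simp only [mul_pow, sq_abs] at this
        simp only [LinearMap.sub_apply, LinearMap.add_apply, LinearMap.smul_apply,
          LinearMap.compl₁₂_apply, sformBilin_apply, smul_eq_mul]
        linear_combination this
    simp only [LinearMap.sub_apply, LinearMap.add_apply, LinearMap.smul_apply,
      LinearMap.compl₁₂_apply, sformBilin_apply, smul_eq_mul] at hor
    rcases hor with h | h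
    · exact absurd (fun ζ => sub_eq_zero.mp (h ζ)) (not_sform_similar hrs hc Cτ)
    · exact eq_neg_of_add_eq_zero_left (h ζ)
  have hpolar (ζ ζ' : Fin (s + r) → ℝ) :
      sform r s (Cτ ζ) (Cτ ζ') = -(c * sform s r ζ ζ') := by
    have h := hneg (ζ + ζ')
    simp only [← sformBilin_apply, map_add, LinearMap.add_apply] at h
    simp only [sformBilin_apply, hneg, sform_comm r s (Cτ ζ') (Cτ ζ), sform_comm s r ζ' ζ] at h
    linarith
  obtain ⟨t, ht, htc⟩ : ∃ t : ℝ, t ≠ 0 ∧ t ^ 2 * t ^ 2 * c = 1 := by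
    refine ⟨√√c⁻¹, by positivity, ?_⟩
    rw [Real.sq_sqrt (by positivity), ← sq, Real.sq_sqrt (by positivity),
      inv_mul_cancel₀ hc.ne']
  let D : (V2 × (Fin (s + r) → ℝ)) ≃ₗ[ℝ] (V2 × (Fin (s + r) → ℝ)) :=
    (LinearEquiv.smulOfNeZero ℝ V2 t ht).prodCongr
      (LinearEquiv.smulOfNeZero ℝ (Fin (s + r) → ℝ) (t ^ 2) (pow_ne_zero 2 ht))
  have hD (x : V2 × (Fin (s + r) → ℝ)) : D x = (t • x.1, t ^ 2 • x.2) := rfl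
  have hadj (Z : Fin (r + s) → ℝ) (ζ : Fin (s + r) → ℝ) :
      sform s r ((t ^ 2 • C) Z) ζ = sform r s Z ((t ^ 2 • Cτ) ζ) := by
    simp only [← sformBilin_apply, LinearMap.smul_apply, map_smul]
    simp only [sformBilin_apply, hCτ]
  have hCτiso (ζ ζ' : Fin (s + r) → ℝ) :
      sform r s ((t ^ 2 • Cτ) ζ) ((t ^ 2 • Cτ) ζ') = -(sform s r ζ ζ') := by
    simp only [← sformBilin_apply, LinearMap.smul_apply, map_smul, smul_eq_mul]
    simp only [sformBilin_apply, hpolar]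
    linear_combination -(sform s r ζ ζ') * htc
  have hCCτ (ζ : Fin (s + r) → ℝ) : (t ^ 2 • C) ((t ^ 2 • Cτ) ζ) = -ζ := by
    refine sform_ext (r := s) (s := r) fun ξ => ?_
    rw [hadj, hCτiso]
    simp [← sformBilin_apply]
  have hCτsurj : Function.Surjective (t ^ 2 • Cτ) :=
    (LinearMap.injective_iff_surjective_of_finrank_eq_finrank (by simp [add_comm])).mp
      fun ζ ζ' h => neg_injective (by rw [← hCCτ, ← hCCτ, h])
  have hCτC (Z : Fin (r + s) → ℝ) : (t ^ 2 • Cτ) ((t ^ 2 • C) Z) = -Z := by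
    obtain ⟨ζ, rfl⟩ := hCτsurj Z
    rw [hCCτ, map_neg]
  refine ⟨f.trans D, t ^ 2 • C, t ^ 2 • Cτ, fun x y => ?_, fun Z => ?_, fun ζ => ?_, hadj,
    hCCτ, hCτC, fun Z Z' => ?_, hCτiso⟩
  · simp only [LinearEquiv.trans_apply, hf x y, hD, smul_zero, map_smul, LinearMap.smul_apply,
      smul_smul, sq]
  · simp only [LinearEquiv.trans_apply, hfC, hD, smul_zero, LinearMap.smul_apply]
  · exact ⟨(t ^ 2 • Cτ) (-ζ), by rw [hCCτ, neg_neg]⟩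
  · rw [hadj, hCτC]
    simp [← sformBilin_apply]
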